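/- arXiv:2112.11882 — 2 statements merged into one kernel-verified Lean document; each statement's English description precedes it below -/
import Mathlib

section
/- φ(e^{−π}) = π^{1/4} / Γ(3/4), where φ(q) = ∑_{n ∈ ℤ} q^{n²}. -/
open Real

/-- Ramanujan's theta function `φ(q) = ∑_{n ∈ ℤ} q^{n²}`. -/
noncomputable def phi (q : ℝ) : ℝ := ∑' n : ℤ, q ^ (n.natAbs ^ 2)

open Filter Topology MeasureTheory Set

theorem summable_norm_pow_natAbs_sq {q : ℝ} (hq : |q| < 1) :
    Summable fun n : ℤ => ‖q ^ (n.natAbs ^ 2)‖ := by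
  have h : Summable fun n : ℕ => |q| ^ (n ^ 2) :=
    Summable.of_nonneg_of_le (fun n => by positivity)
      (fun n => pow_le_pow_of_le_one (abs_nonneg q) hq.le (Nat.le_self_pow two_ne_zero n))
      (summable_geometric_of_lt_one (abs_nonneg q) hq)
  apply Summable.of_nat_of_neg <;> simpa using h

theorem hasSum_phi_mul_phi {q r : ℝ} (hq : |q| < 1) (hr : |r| < 1) :
    HasSum (fun p : ℤ × ℤ => q ^ (p.1.natAbs ^ 2) * r ^ (p.2.natAbs ^ 2)) (phi q * phi r) := by
  rw [phi, phi, tsum_mul_tsum_of_summable_norm (summable_norm_pow_natAbs_sq hq)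
    (summable_norm_pow_natAbs_sq hr)]
  exact (summable_mul_of_summable_norm (summable_norm_pow_natAbs_sq hq)
    (summable_norm_pow_natAbs_sq hr)).hasSum

theorem tsum_eq_tsum_add_sub {f : ℤ × ℤ → ℝ} (hf : ∀ p, Odd (p.1 + p.2) → f p = 0) :
    ∑' p, f p = ∑' p : ℤ × ℤ, f (p.1 + p.2, p.1 - p.2) := by
  have hinj : Function.Injective fun p : ℤ × ℤ => (p.1 + p.2, p.1 - p.2) := by
    rintro ⟨a, b⟩ ⟨c, d⟩ h
    simp only [Prod.mk.injEq] at h ⊢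
    omega
  refine (hinj.tsum_eq ?_).symm
  rintro ⟨m, n⟩ hmn
  rcases Int.even_or_odd (m + n) with ⟨k, hk⟩ | h
  · exact ⟨(k, m - k), by ext <;> simp; omega⟩
  · exact absurd (hf _ h) hmn

theorem natAbs_add_sq_add_natAbs_sub_sq (u v : ℤ) :
    (u + v).natAbs ^ 2 + (u - v).natAbs ^ 2 = 2 * (u.natAbs ^ 2 + v.natAbs ^ 2) := by
  zify
  simp only [sq_abs]
  ring

theorem phi_sq_add_phi_neg_sq {q : ℝ} (hq : |q| < 1) :
    phi q ^ 2 + phi (-q) ^ 2 = 2 * phi (q ^ 2) ^ 2 := by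
  have hq' : |-q| < 1 := by rwa [abs_neg]
  have hq2 : |q ^ 2| < 1 := by
    rw [abs_pow]; exact pow_lt_one₀ (abs_nonneg q) hq two_ne_zero
  have h := ((hasSum_phi_mul_phi hq hq).add (hasSum_phi_mul_phi hq' hq')).tsum_eq
  rw [tsum_eq_tsum_add_sub] at h
  · rw [sq, sq, ← h, sq (phi (q ^ 2)), ← (hasSum_phi_mul_phi hq2 hq2).tsum_eq, ← tsum_mul_left]
    congr 1 with ⟨u, v⟩
    simp only [← pow_add, natAbs_add_sq_add_natAbs_sub_sq, ← pow_mul, pow_mul (-q), neg_sq]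
    ring
  · rintro ⟨m, n⟩ hmn
    have : Odd (m.natAbs ^ 2 + n.natAbs ^ 2) := by
      rwa [Nat.odd_add, ← Nat.not_even_iff_odd, Nat.even_pow' two_ne_zero,
        Nat.even_pow' two_ne_zero, Int.natAbs_even, Int.natAbs_even, Int.not_even_iff_odd,
        ← Int.odd_add]
    simp only [← pow_add, this.neg_pow, add_neg_cancel]

theorem phi_mul_phi_neg {q : ℝ} (hq : |q| < 1) :
    phi q * phi (-q) = phi (-q ^ 2) ^ 2 := by
  have hq' : |-q| < 1 := by rwa [abs_neg]
  have hq2 : |-q ^ 2| < 1 := by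
    rw [abs_neg, abs_pow]; exact pow_lt_one₀ (abs_nonneg q) hq two_ne_zero
  have hparity (x : ℝ) (n : ℤ) :
      (-x) ^ (n.natAbs ^ 2) = (if Even n then 1 else -1) * x ^ (n.natAbs ^ 2) := by
    split_ifs with h
    · rw [Even.neg_pow (by simpa [parity_simps] using h), one_mul]
    · rw [Odd.neg_pow ((Int.natAbs_odd.mpr (Int.not_even_iff_odd.mp h)).pow), neg_one_mul]
  have h := ((hasSum_phi_mul_phi hq hq').add (hasSum_phi_mul_phi hq' hq)).tsum_eq
  rw [tsum_eq_tsum_add_sub] at h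
  · have h2 : 2 * (phi q * phi (-q)) = 2 * phi (-q ^ 2) ^ 2 := by
      rw [two_mul]
      nth_rw 2 [mul_comm]
      rw [← h, sq (phi _), ← (hasSum_phi_mul_phi hq2 hq2).tsum_eq, ← tsum_mul_left]
      congr 1 with ⟨u, v⟩
      have key : q ^ ((u + v).natAbs ^ 2) * q ^ ((u - v).natAbs ^ 2) =
          (q ^ 2) ^ (u.natAbs ^ 2) * (q ^ 2) ^ (v.natAbs ^ 2) := by
        simp only [← pow_add, natAbs_add_sq_add_natAbs_sub_sq, ← pow_mul, mul_add]
      simp only [hparity]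
      by_cases hu : Even u <;> by_cases hv : Even v <;>
        simp only [hu, hv, parity_simps, iff_self, iff_true, iff_false, not_true,
          if_true, if_false]
      · linear_combination 2 * key
      · linear_combination -2 * key
      · linear_combination -2 * key
      · linear_combination 2 * key
    linarith
  · rintro ⟨m, n⟩ hmn
    simp only [hparity]
    rw [← Int.not_even_iff_odd, Int.even_add] at hmn
    by_cases hm : Even m <;> by_cases hn : Even n <;>
      simp only [hm, hn, iff_self, not_true, if_true, if_false] at hmn ⊢ <;> ring

theorem tendsto_phi_zero : Tendsto phi (𝓝 0) (𝓝 1) := by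
  have h1 : phi 0 = 1 := by
    rw [phi, tsum_eq_single 0] <;> simp
  have := tendsto_tsum_of_dominated_convergence (𝓕 := 𝓝 (0 : ℝ))
    (f := fun q (n : ℤ) => q ^ (n.natAbs ^ 2)) (g := fun n => 0 ^ (n.natAbs ^ 2))
    (summable_norm_pow_natAbs_sq (q := 1 / 2) (by norm_num [abs_lt]))
    (fun n => (continuous_pow _).tendsto 0) ?_
  · rw [← h1]; exact this
  · filter_upwards [Metric.ball_mem_nhds (0 : ℝ) (show (0 : ℝ) < 1 / 2 by norm_num)] with q hq n
    rw [norm_pow, norm_pow]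
    gcongr
    rw [mem_ball_zero_iff] at hq
    norm_num at hq ⊢
    exact hq.le

theorem phi_pos {q : ℝ} (hq : 0 ≤ q) (hq1 : q < 1) : 0 < phi q :=
  (summable_norm_pow_natAbs_sq (by rwa [abs_of_nonneg hq])).of_norm.tsum_pos
    (fun n => by positivity) 0 (by simp)

theorem phi_exp_neg_pi_mul {t : ℝ} (ht : 0 < t) :
    phi (rexp (-(π * t))) = 1 / t ^ (1 / 2 : ℝ) * phi (rexp (-(π / t))) := by
  have := Real.tsum_exp_neg_mul_int_sq ht
  have e (x : ℝ) (n : ℤ) : rexp x ^ (n.natAbs ^ 2) = rexp (x * (n : ℝ) ^ 2) := by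
    rw [← Real.exp_nat_mul, mul_comm]
    push_cast
    simp [Nat.cast_natAbs]
  simpa [phi, e, neg_div] using this

/-- Gauss's form of the complete elliptic integral, `∫ dt / √((a² + t²)(b² + t²))` over `ℝ`. -/
noncomputable def gaussIntegral (a b : ℝ) : ℝ :=
  ∫ t : ℝ, (√((a ^ 2 + t ^ 2) * (b ^ 2 + t ^ 2)))⁻¹

theorem gaussIntegral_eq_two_mul_integral_Ioi (a b : ℝ) :
    gaussIntegral a b = 2 * ∫ t in Ioi (0 : ℝ), (√((a ^ 2 + t ^ 2) * (b ^ 2 + t ^ 2)))⁻¹ := by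
  rw [gaussIntegral, ← integral_comp_abs]
  simp only [sq_abs]

theorem image_sub_div_Ioi {c : ℝ} (hc : 0 < c) :
    (fun t : ℝ => (t - c / t) / 2) '' Ioi 0 = univ := by
  refine eq_univ_of_forall fun u => ?_
  have h1 : u ^ 2 < u ^ 2 + c := by linarith
  have h2 : 0 < u + √(u ^ 2 + c) := by
    have := Real.lt_sqrt_of_sq_lt (x := |u|) (y := u ^ 2 + c) (by rw [sq_abs]; exact h1)
    linarith [neg_abs_le u]
  refine ⟨u + √(u ^ 2 + c), h2, ?_⟩
  have h3 := Real.sq_sqrt (show 0 ≤ u ^ 2 + c by positivity)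
  field_simp
  linear_combination h3

theorem injOn_sub_div_Ioi {c : ℝ} (hc : 0 < c) :
    InjOn (fun t : ℝ => (t - c / t) / 2) (Ioi 0) := by
  intro s (hs : 0 < s) t (ht : 0 < t) hst
  have h : (s - t) * (s * t + c) = 0 := by
    field_simp at hst
    linear_combination hst
  rcases mul_eq_zero.mp h with h | h
  · linarith
  · nlinarith [mul_pos hs ht]

/-- Gauss's transformation: one arithmetic-geometric mean step preserves the integral. -/
theorem gaussIntegral_agm_step {a b a' b' : ℝ} (ha : 0 < a) (hb : 0 < b)
    (ha' : a' = (a + b) / 2) (hb' : b' ^ 2 = a * b) :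
    gaussIntegral a' b' = gaussIntegral a b := by
  have hc : 0 < a * b := mul_pos ha hb
  have hderiv : ∀ t ∈ Ioi (0 : ℝ), HasDerivWithinAt (fun t : ℝ => (t - a * b / t) / 2)
      ((1 + a * b / t ^ 2) / 2) (Ioi 0) t := by
    intro t (ht : 0 < t)
    have := (((hasDerivAt_id t).sub ((hasDerivAt_inv ht.ne').const_mul (a * b))).div_const 2)
    refine (this.congr_deriv ?_).hasDerivWithinAt
    ring
  rw [gaussIntegral_eq_two_mul_integral_Ioi a b, gaussIntegral, ← setIntegral_univ,
    ← image_sub_div_Ioi hc, integral_image_eq_integral_abs_deriv_smul measurableSet_Ioi hderiv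
      (injOn_sub_div_Ioi hc), ← integral_const_mul]
  refine setIntegral_congr_fun measurableSet_Ioi fun t (ht : 0 < t) => ?_
  have h1 : (a' ^ 2 + ((t - a * b / t) / 2) ^ 2) * (b' ^ 2 + ((t - a * b / t) / 2) ^ 2) =
      ((t ^ 2 + a * b) / (4 * t ^ 2)) ^ 2 * ((a ^ 2 + t ^ 2) * (b ^ 2 + t ^ 2)) := by
    rw [ha', hb']
    field_simp
    ring
  have h2 : 0 < √((a ^ 2 + t ^ 2) * (b ^ 2 + t ^ 2)) := by positivity
  simp only [smul_eq_mul]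
  rw [h1, Real.sqrt_mul (by positivity), Real.sqrt_sq (by positivity), abs_of_pos (by positivity)]
  field_simp
  ring

theorem integrable_inv_sq_add_sq {a : ℝ} (ha : 0 < a) :
    Integrable fun t : ℝ => (a ^ 2 + t ^ 2)⁻¹ := by
  convert ((integrable_inv_one_add_sq.comp_div ha.ne').const_mul (a ^ 2)⁻¹) using 2 with t
  field_simp

theorem integral_univ_inv_sq_add_sq {a : ℝ} (ha : 0 < a) :
    ∫ t : ℝ, (a ^ 2 + t ^ 2)⁻¹ = π / a := by
  have h := Measure.integral_comp_div (fun t : ℝ => (1 + t ^ 2)⁻¹) a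
  rw [integral_univ_inv_one_add_sq, abs_of_pos ha] at h
  have : (fun t : ℝ => (a ^ 2 + t ^ 2)⁻¹) = fun t => (a ^ 2)⁻¹ * (1 + (t / a) ^ 2)⁻¹ := by
    ext t
    field_simp
  rw [this, integral_const_mul, h, smul_eq_mul]
  field_simp

theorem gaussIntegral_mem_Icc {a b : ℝ} (hb : 0 < b) (hab : b ≤ a) :
    gaussIntegral a b ∈ Icc (π / a) (π / b) := by
  have ha := hb.trans_le hab
  have hle (t : ℝ) : b ^ 2 + t ^ 2 ≤ a ^ 2 + t ^ 2 := by gcongr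
  have hlow (t : ℝ) : (a ^ 2 + t ^ 2)⁻¹ ≤ (√((a ^ 2 + t ^ 2) * (b ^ 2 + t ^ 2)))⁻¹ := by
    have : 0 < a ^ 2 + t ^ 2 := by positivity
    gcongr
    rw [Real.sqrt_le_left this.le, sq (a ^ 2 + t ^ 2)]
    exact mul_le_mul_of_nonneg_left (hle t) this.le
  have hup (t : ℝ) : (√((a ^ 2 + t ^ 2) * (b ^ 2 + t ^ 2)))⁻¹ ≤ (b ^ 2 + t ^ 2)⁻¹ := by
    have : 0 < b ^ 2 + t ^ 2 := by positivity
    gcongr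
    apply Real.le_sqrt_of_sq_le
    rw [sq (b ^ 2 + t ^ 2)]
    exact mul_le_mul_of_nonneg_right (hle t) this.le
  have hint : Integrable fun t : ℝ => (√((a ^ 2 + t ^ 2) * (b ^ 2 + t ^ 2)))⁻¹ := by
    refine (integrable_inv_sq_add_sq hb).mono' (by fun_prop) (.of_forall fun t => ?_)
    rw [Real.norm_of_nonneg (by positivity)]
    exact hup t
  constructor
  · rw [← integral_univ_inv_sq_add_sq ha]
    exact integral_mono (integrable_inv_sq_add_sq ha) hint hlow
  · rw [← integral_univ_inv_sq_add_sq hb]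
    exact integral_mono hint (integrable_inv_sq_add_sq hb) hup

theorem gaussIntegral_smul {c : ℝ} (hc : 0 < c) (a b : ℝ) :
    gaussIntegral (c * a) (c * b) = gaussIntegral a b / c := by
  have h := Measure.integral_comp_div
    (fun t : ℝ => (√((a ^ 2 + t ^ 2) * (b ^ 2 + t ^ 2)))⁻¹) c
  have h2 : (fun t : ℝ => (√(((c * a) ^ 2 + t ^ 2) * ((c * b) ^ 2 + t ^ 2)))⁻¹) =
      fun t => (c ^ 2)⁻¹ * (√((a ^ 2 + (t / c) ^ 2) * (b ^ 2 + (t / c) ^ 2)))⁻¹ := by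
    ext t
    rw [← mul_inv, show c ^ 2 = √((c ^ 2) ^ 2) from (Real.sqrt_sq (by positivity)).symm,
      ← Real.sqrt_mul (by positivity)]
    congr 2
    field_simp
  rw [gaussIntegral, h2, integral_const_mul, h, abs_of_pos hc, smul_eq_mul, gaussIntegral]
  field_simp

theorem integral_rpow_mul_one_sub_rpow {u v : ℝ} (hu : 0 < u) (hv : 0 < v) :
    ∫ x in Ioo (0 : ℝ) 1, x ^ (u - 1) * (1 - x) ^ (v - 1) =
      Gamma u * Gamma v / Gamma (u + v) := by
  have h := Complex.betaIntegral_eq_Gamma_mul_div u v (by simpa) (by simpa)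
  rw [Complex.betaIntegral, intervalIntegral.integral_of_le zero_le_one,
    integral_Ioc_eq_integral_Ioo] at h
  have h2 : ∫ x in Ioo (0 : ℝ) 1, (x : ℂ) ^ ((u : ℂ) - 1) * (1 - (x : ℂ)) ^ ((v : ℂ) - 1) =
      ∫ x in Ioo (0 : ℝ) 1, ((x ^ (u - 1) * (1 - x) ^ (v - 1) : ℝ) : ℂ) := by
    refine setIntegral_congr_fun measurableSet_Ioo fun x hx => ?_
    push_cast
    rw [Complex.ofReal_cpow hx.1.le, Complex.ofReal_cpow (sub_nonneg.mpr hx.2.le)]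
    push_cast
    rfl
  rw [h2, integral_complex_ofReal, ← Complex.ofReal_add, Complex.Gamma_ofReal, Complex.Gamma_ofReal,
    Complex.Gamma_ofReal] at h
  exact_mod_cast h

theorem image_inv_one_add_sq_sq_Ioi :
    (fun t : ℝ => ((1 + t ^ 2) ^ 2)⁻¹) '' Ioi 0 = Ioo 0 1 := by
  ext x
  constructor
  · rintro ⟨t, ht : 0 < t, rfl⟩
    refine ⟨by positivity, inv_lt_one_of_one_lt₀ ?_⟩
    nlinarith [pow_pos ht 2]
  · rintro ⟨h0, h1⟩
    have hs0 : 0 < √x := Real.sqrt_pos.mpr h0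
    have hs1 : √x < 1 := by rw [Real.sqrt_lt' one_pos]; simpa
    have h3 : 0 < (√x)⁻¹ - 1 := sub_pos.mpr ((one_lt_inv₀ hs0).mpr hs1)
    refine ⟨√((√x)⁻¹ - 1), Real.sqrt_pos.mpr h3, ?_⟩
    simp only
    rw [Real.sq_sqrt h3.le, add_sub_cancel, inv_pow, Real.sq_sqrt h0.le, inv_inv]

theorem gaussIntegral_sqrt_two_one :
    gaussIntegral (√2) 1 = Gamma (1 / 4) * Gamma (1 / 2) / Gamma (3 / 4) / 2 := by
  have hderiv : ∀ t ∈ Ioi (0 : ℝ), HasDerivWithinAt (fun t : ℝ => ((1 + t ^ 2) ^ 2)⁻¹)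
      (-(4 * t / (1 + t ^ 2) ^ 3)) (Ioi 0) t := by
    intro t ht
    have h := ((((hasDerivAt_id t).pow 2).const_add 1).pow 2).inv
      (by simp only [id, Pi.pow_apply]; positivity)
    refine (h.congr_deriv ?_).hasDerivWithinAt
    simp only [id, Pi.pow_apply]
    field_simp
    norm_num
    ring
  have hinj : InjOn (fun t : ℝ => ((1 + t ^ 2) ^ 2)⁻¹) (Ioi 0) := by
    intro s (hs : 0 < s) t (ht : 0 < t) h
    have h1 := inv_injective h
    rw [pow_left_inj₀ (by positivity) (by positivity) two_ne_zero, add_right_inj,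
      pow_left_inj₀ hs.le ht.le two_ne_zero] at h1
    exact h1
  have hbeta := integral_rpow_mul_one_sub_rpow (u := 1 / 4) (v := 1 / 2) (by norm_num) (by norm_num)
  rw [← image_inv_one_add_sq_sq_Ioi,
    integral_image_eq_integral_abs_deriv_smul measurableSet_Ioi hderiv hinj,
    show (1 / 4 + 1 / 2 : ℝ) = 3 / 4 by norm_num] at hbeta
  rw [gaussIntegral_eq_two_mul_integral_Ioi, ← hbeta, eq_div_iff two_ne_zero, mul_right_comm,
    ← integral_const_mul]
  refine setIntegral_congr_fun measurableSet_Ioi fun t (ht : 0 < t) => ?_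
  have h1 : 0 < 1 + t ^ 2 := by positivity
  have h2 : 0 < 2 + t ^ 2 := by positivity
  have e1 : (((1 + t ^ 2) ^ 2)⁻¹ : ℝ) ^ (1 / 4 - 1 : ℝ) = (1 + t ^ 2) * √(1 + t ^ 2) := by
    rw [Real.inv_rpow (by positivity), ← Real.rpow_neg (by positivity), ← Real.rpow_natCast,
      ← Real.rpow_mul h1.le, Real.sqrt_eq_rpow, ← Real.rpow_one_add' h1.le (by norm_num)]
    norm_num
  have e2 : (1 - ((1 + t ^ 2) ^ 2)⁻¹ : ℝ) ^ (1 / 2 - 1 : ℝ) =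
      (1 + t ^ 2) / (t * √(2 + t ^ 2)) := by
    have : (1 - ((1 + t ^ 2) ^ 2)⁻¹ : ℝ) = (t / (1 + t ^ 2)) ^ 2 * (2 + t ^ 2) := by
      field_simp
      ring
    rw [this, show (1 / 2 - 1 : ℝ) = -(1 / 2) by norm_num, Real.rpow_neg (by positivity),
      ← Real.sqrt_eq_rpow, Real.sqrt_mul (by positivity), Real.sqrt_sq (by positivity)]
    field_simp
  simp only [smul_eq_mul]
  rw [e1, e2, abs_neg, abs_of_pos (by positivity), Real.sq_sqrt zero_le_two, one_pow,
    Real.sqrt_mul h2.le]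
  have h3 := Real.sq_sqrt h1.le
  have h4 : 0 < √(1 + t ^ 2) := by positivity
  have h5 : 0 < √(2 + t ^ 2) := by positivity
  field_simp
  rw [h3]
  ring

theorem abs_phi_neg_le {q : ℝ} (hq : 0 ≤ q) (hq1 : q < 1) : |phi (-q)| ≤ phi q := by
  have hs := summable_norm_pow_natAbs_sq (q := -q) (by rwa [abs_neg, abs_of_nonneg hq])
  refine (norm_tsum_le_tsum_norm hs).trans_eq ?_
  simp only [norm_pow, norm_neg, Real.norm_of_nonneg hq, phi]

theorem phi_neg_pow_ne_zero_and_gaussIntegral_eq {q : ℝ} (hq : 0 ≤ q) (hq1 : q < 1)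
    (h0 : phi (-q) ≠ 0) (n : ℕ) :
    phi (-q ^ 2 ^ n) ≠ 0 ∧
      gaussIntegral (phi (q ^ 2 ^ n) ^ 2) (phi (-q ^ 2 ^ n) ^ 2) =
        gaussIntegral (phi q ^ 2) (phi (-q) ^ 2) := by
  induction n with
  | zero => simpa using h0
  | succ n ih =>
    obtain ⟨hne, hI⟩ := ih
    have hx : 0 ≤ q ^ 2 ^ n := by positivity
    have hx1 : q ^ 2 ^ n < 1 := pow_lt_one₀ hq hq1 (by positivity)
    rw [pow_succ 2 n, pow_mul, ← hI]
    generalize q ^ 2 ^ n = x at *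
    have hxa : |x| < 1 := by rwa [abs_of_nonneg hx]
    have hpos := phi_pos hx hx1
    have hmul := phi_mul_phi_neg hxa
    refine ⟨fun h => mul_ne_zero hpos.ne' hne (by rw [hmul, h]; simp), ?_⟩
    refine gaussIntegral_agm_step (by positivity) (by positivity) ?_ ?_
    · rw [phi_sq_add_phi_neg_sq hxa]
      ring
    · rw [← hmul]
      ring

theorem gaussIntegral_phi_sq {q : ℝ} (hq : 0 ≤ q) (hq1 : q < 1) (h0 : phi (-q) ≠ 0) :
    gaussIntegral (phi q ^ 2) (phi (-q) ^ 2) = π := by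
  have hlim : Tendsto (fun n : ℕ => q ^ 2 ^ n) atTop (𝓝 0) :=
    (tendsto_pow_atTop_nhds_zero_of_lt_one hq hq1).comp
      (tendsto_pow_atTop_atTop_of_one_lt one_lt_two)
  have hbounds (n : ℕ) : gaussIntegral (phi q ^ 2) (phi (-q) ^ 2) ∈
      Icc (π / phi (q ^ 2 ^ n) ^ 2) (π / phi (-q ^ 2 ^ n) ^ 2) := by
    obtain ⟨hne, hI⟩ := phi_neg_pow_ne_zero_and_gaussIntegral_eq hq hq1 h0 n
    rw [← hI]
    refine gaussIntegral_mem_Icc (by positivity) (sq_le_sq' ?_ ?_) <;>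
      linarith [abs_le.mp (abs_phi_neg_le (q := q ^ 2 ^ n) (by positivity)
        (pow_lt_one₀ hq hq1 (by positivity)))]
  have hpi {u : ℕ → ℝ} (hu : Tendsto u atTop (𝓝 0)) :
      Tendsto (fun n => π / phi (u n) ^ 2) atTop (𝓝 π) := by
    have h := (tendsto_const_nhds (x := π)).div ((tendsto_phi_zero.comp hu).pow 2) (by norm_num)
    rw [one_pow, div_one] at h
    exact h
  exact le_antisymm (ge_of_tendsto' (hpi (by simpa using hlim.neg)) fun n => (hbounds n).2)
    (le_of_tendsto' (hpi hlim) fun n => (hbounds n).1)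

theorem phi_exp_neg_pi_sq :
    phi (rexp (-π)) ^ 2 = √2 * phi (-rexp (-π)) ^ 2 := by
  have hq : |rexp (-(π / 2))| < 1 := by
    rw [abs_of_pos (exp_pos _), exp_lt_one_iff]
    linarith [pi_pos]
  have hq2 : |rexp (-π)| < 1 := by
    rw [abs_of_pos (exp_pos _), exp_lt_one_iff]
    linarith [pi_pos]
  have e1 : rexp (-(π / 2)) ^ 2 = rexp (-π) := by
    rw [← Real.exp_nat_mul]
    congr 1
    push_cast
    ring
  have e2 : rexp (-π) ^ 2 = rexp (-(π * 2)) := by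
    rw [← Real.exp_nat_mul]
    congr 1
    push_cast
    ring
  have h1 := phi_sq_add_phi_neg_sq hq
  have h2 := phi_mul_phi_neg hq
  have h3 := phi_sq_add_phi_neg_sq hq2
  have h4 := phi_exp_neg_pi_mul two_pos
  rw [← Real.sqrt_eq_rpow] at h4
  rw [e1] at h1 h2
  rw [e2, h4, mul_pow, div_pow, Real.sq_sqrt zero_le_two] at h3
  have h5 : (phi (rexp (-π)) ^ 2) ^ 2 = (√2 * phi (-rexp (-π)) ^ 2) ^ 2 := by
    rw [mul_pow, Real.sq_sqrt zero_le_two]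
    generalize phi (rexp (-(π / 2))) = A at *
    generalize phi (-rexp (-(π / 2))) = B at *
    generalize phi (rexp (-π)) = T at *
    generalize phi (-rexp (-π)) = C at *
    have hA : A ^ 2 = T ^ 2 + C ^ 2 := by linarith
    have hB : B ^ 2 = T ^ 2 - C ^ 2 := by linarith
    have hAB : A ^ 2 * B ^ 2 = (C ^ 2) ^ 2 := by rw [← h2]; ring
    rw [hA, hB] at hAB
    linarith
  exact (pow_left_inj₀ (by positivity) (by positivity) two_ne_zero).mp h5

theorem phi_exp_neg_pi :
    phi (Real.exp (-π)) = π ^ ((1:ℝ)/4) / Real.Gamma (3/4) := by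
  have hq1 : rexp (-π) < 1 := by
    rw [exp_lt_one_iff]
    linarith [pi_pos]
  have hpos := phi_pos (exp_pos (-π)).le hq1
  have hsq := phi_exp_neg_pi_sq
  have hne : phi (-rexp (-π)) ≠ 0 := by
    intro h
    rw [h] at hsq
    exact hpos.ne' (by simpa using hsq)
  have hI := gaussIntegral_phi_sq (exp_pos (-π)).le hq1 hne
  have hC : 0 < phi (-rexp (-π)) ^ 2 := by positivity
  have hscale := gaussIntegral_smul hC (√2) 1
  rw [mul_comm _ √2, ← hsq, mul_one, hI, gaussIntegral_sqrt_two_one, eq_div_iff hC.ne',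
    Gamma_one_half_eq] at hscale
  have hrefl := Real.Gamma_mul_Gamma_one_sub (1 / 4)
  rw [show (1 - 1 / 4 : ℝ) = 3 / 4 by norm_num, show π * (1 / 4) = π / 4 by ring,
    sin_pi_div_four] at hrefl
  have hG : 0 < Gamma (3 / 4) := Gamma_pos_of_pos (by norm_num)
  rw [← eq_div_iff hG.ne'] at hrefl
  have key : phi (rexp (-π)) ^ 2 = √π / Gamma (3 / 4) ^ 2 := by
    rw [hsq]
    have : phi (-rexp (-π)) ^ 2 = √π / (√2 * Gamma (3 / 4) ^ 2) := by
      rw [← mul_right_inj' pi_ne_zero, hscale, hrefl]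
      field_simp
    rw [this]
    field_simp
  refine (pow_left_inj₀ hpos.le (by positivity) two_ne_zero).mp ?_
  rw [key, div_pow, ← Real.rpow_mul_natCast pi_pos.le, Real.sqrt_eq_rpow]
  norm_num
end

section
/- φ(e^{−3π}) / φ(e^{−π}) = 1 / (6√3 − 9)^{1/4}, where φ(q) = ∑_{n ∈ ℤ} q^{n²}. -/
open Real

open scoped ENNReal

/-- The sum of `f` over the residue class of `k` modulo `3`. -/
noncomputable def residueSum (f : ℤ → ℝ≥0∞) (k : ℤ) : ℝ≥0∞ := ∑' m : ℤ, f (3 * m + k)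

lemma residueSum_add_three_mul (f : ℤ → ℝ≥0∞) (k j : ℤ) :
    residueSum f (3 * j + k) = residueSum f k := by
  rw [residueSum, residueSum, ← (Equiv.addRight j).tsum_eq (fun m : ℤ => f (3 * m + k))]
  refine tsum_congr fun m => congrArg f ?_
  simp only [Equiv.coe_addRight]
  ring

lemma residueSum_neg {f : ℤ → ℝ≥0∞} (hf : ∀ n, f (-n) = f n) (k : ℤ) :
    residueSum f (-k) = residueSum f k := by
  rw [residueSum, residueSum, ← (Equiv.neg ℤ).tsum_eq]
  refine tsum_congr fun m => ?_
  rw [← hf]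
  congr 1
  simp only [Equiv.neg_apply]
  ring

lemma residueSum_two {f : ℤ → ℝ≥0∞} (hf : ∀ n, f (-n) = f n) :
    residueSum f 2 = residueSum f 1 := by
  rw [← residueSum_neg hf 1, ← residueSum_add_three_mul f (-1) 1]
  norm_num

lemma tsum_int_eq_three (g : ℤ → ℝ≥0∞) :
    ∑' n, g n = residueSum g 0 + residueSum g 1 + residueSum g 2 := by
  rw [← (Int.divModEquiv 3).symm.tsum_eq, ENNReal.tsum_prod']
  simp only [tsum_fintype, Fin.sum_univ_three, Int.divModEquiv_symm_apply, residueSum,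
    ENNReal.tsum_add]
  norm_num [mul_comm]

lemma tsum_mul_periodic (f h : ℤ → ℝ≥0∞) (hh : ∀ j k, h (3 * j + k) = h k) :
    ∑' n, f n * h n =
      residueSum f 0 * h 0 + residueSum f 1 * h 1 + residueSum f 2 * h 2 := by
  rw [tsum_int_eq_three]
  simp only [residueSum, hh, ENNReal.tsum_mul_right]

/-- The weight enumerator `x⁴ + 8xy³` of the ternary tetracode. -/
lemma tsum_tetracode {f : ℤ → ℝ≥0∞} (hf : ∀ n, f (-n) = f n) :
    ∑' a : ℤ, ∑' b : ℤ, f a * f b * residueSum f (-a - b) * residueSum f (b - a) =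
      residueSum f 0 ^ 4 + 8 * (residueSum f 0 * residueSum f 1 ^ 3) := by
  have inner (a : ℤ) := tsum_mul_periodic f
    (fun b => residueSum f (-a - b) * residueSum f (b - a)) (fun j k => by
      rw [← residueSum_add_three_mul f (-a - k) (-j), ← residueSum_add_three_mul f (k - a) j]
      ring_nf)
  have outer := tsum_mul_periodic f
    (fun a => ∑' b, f b * (residueSum f (-a - b) * residueSum f (b - a))) (fun j k => by
      refine tsum_congr fun b => ?_
      rw [← residueSum_add_three_mul f (-k - b) (-j), ← residueSum_add_three_mul f (b - k) (-j)]
      ring_nf)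
  simp only [mul_assoc, ENNReal.tsum_mul_left] at outer ⊢
  rw [outer, inner, inner, inner]
  have h3 : residueSum f 3 = residueSum f 0 := residueSum_add_three_mul f 0 1
  have h4 : residueSum f 4 = residueSum f 1 := residueSum_add_three_mul f 1 1
  norm_num [residueSum_neg hf, residueSum_two hf, h3, h4]
  ring

/-- The isometry between `√3 ℤ⁴` and the lattice attached to the tetracode. -/
lemma tsum_pow_four_eq {f g : ℤ → ℝ≥0∞}
    (hfg : ∀ a b m n : ℤ, g m * g n * g (a - m - n) * g (b - m + n) =
      f a * f b * f (3 * m + (-a - b)) * f (3 * n + (b - a))) :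
    (∑' n, g n) ^ 4 =
      ∑' a : ℤ, ∑' b : ℤ, f a * f b * residueSum f (-a - b) * residueSum f (b - a) := by
  calc (∑' n, g n) ^ 4
      = ∑' m, ∑' n, ∑' a, ∑' b, g m * g n * g a * g b := by
        simp only [ENNReal.tsum_mul_left, ENNReal.tsum_mul_right]
        ring
    _ = ∑' m, ∑' n, ∑' a, ∑' b, g m * g n * g (a - m - n) * g (b - m + n) := by
        refine tsum_congr fun m => tsum_congr fun n => ?_
        rw [← (Equiv.addRight (-m - n)).tsum_eq]
        refine tsum_congr fun a => ?_
        rw [← (Equiv.addRight (-m + n)).tsum_eq]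
        refine tsum_congr fun b => ?_
        simp only [Equiv.coe_addRight]
        ring_nf
    _ = ∑' a, ∑' b, ∑' m, ∑' n, g m * g n * g (a - m - n) * g (b - m + n) := by
        simp_rw [ENNReal.tsum_comm (α := ℤ) (β := ℤ)
          (f := fun n a => ∑' b, g _ * g n * g (a - _ - n) * g (b - _ + n))]
        rw [ENNReal.tsum_comm]
        refine tsum_congr fun a => ?_
        simp_rw [ENNReal.tsum_comm (α := ℤ) (β := ℤ)
          (f := fun n b => g _ * g n * g (a - _ - n) * g (b - _ + n))]
        rw [ENNReal.tsum_comm]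
    _ = _ := by
        simp only [hfg, ENNReal.tsum_mul_left, ENNReal.tsum_mul_right, residueSum]

lemma phi_exp_neg_mul_pi (a : ℝ) :
    phi (rexp (-(a * π))) = ∑' n : ℤ, rexp (-π * a * (n : ℝ) ^ 2) := by
  refine tsum_congr fun n => ?_
  rw [← Real.exp_nat_mul]
  push_cast
  rw [Nat.cast_natAbs, Int.cast_abs, sq_abs]
  ring_nf

lemma summable_exp_neg_mul_sq {a : ℝ} (ha : 0 < a) :
    Summable fun n : ℤ => rexp (-π * a * (n : ℝ) ^ 2) := by
  refine (summable_pow_mul_jacobiTheta₂_term_bound 0 ha 0).congr fun n => ?_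
  norm_num [Int.cast_abs, mul_assoc]

lemma tsum_ofReal_exp {a : ℝ} (ha : 0 < a) :
    ∑' n : ℤ, ENNReal.ofReal (rexp (-π * a * (n : ℝ) ^ 2)) =
      ENNReal.ofReal (phi (rexp (-(a * π)))) := by
  rw [phi_exp_neg_mul_pi, ENNReal.ofReal_tsum_of_nonneg (fun _ => (exp_pos _).le)
    (summable_exp_neg_mul_sq ha)]

lemma phi_exp_pos {a : ℝ} (ha : 0 < a) : 0 < phi (rexp (-(a * π))) := by
  rw [phi_exp_neg_mul_pi]
  exact (summable_exp_neg_mul_sq ha).tsum_pos (fun _ => (exp_pos _).le) 0 (exp_pos _)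

lemma phi_exp_neg_pi_div_three :
    phi (rexp (-(1 / 3 * π))) = √3 * phi (rexp (-(3 * π))) := by
  rw [phi_exp_neg_mul_pi, phi_exp_neg_mul_pi, Real.tsum_exp_neg_mul_int_sq (by norm_num),
    ← Real.sqrt_eq_rpow]
  congr 1
  · rw [Real.sqrt_div zero_le_one]
    simp
  · norm_num [div_eq_mul_inv]

lemma phi_exp_neg_pi_pow_four :
    phi (rexp (-(1 * π))) ^ 4 = phi (rexp (-(3 * π))) ^ 4 * (6 * √3 - 9) := by
  set f : ℤ → ℝ≥0∞ := fun n => ENNReal.ofReal (rexp (-π * (1 / 3) * (n : ℝ) ^ 2)) with hf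
  set g : ℤ → ℝ≥0∞ := fun n => ENNReal.ofReal (rexp (-π * 1 * (n : ℝ) ^ 2)) with hg
  have f_even (n : ℤ) : f (-n) = f n := by simp [hf]
  have theta : (∑' n, g n) ^ 4 =
      residueSum f 0 ^ 4 + 8 * (residueSum f 0 * residueSum f 1 ^ 3) := by
    rw [← tsum_tetracode f_even]
    refine tsum_pow_four_eq fun a b m n => ?_
    simp only [hf, hg]
    repeat rw [← ENNReal.ofReal_mul (by positivity)]
    simp only [← Real.exp_add]
    push_cast
    ring_nf
  have zero_class : residueSum f 0 = ENNReal.ofReal (phi (rexp (-(3 * π)))) := by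
    rw [← tsum_ofReal_exp (by norm_num)]
    refine tsum_congr fun n => ?_
    simp only [hf]
    push_cast
    ring_nf
  have total := tsum_int_eq_three f
  rw [residueSum_two f_even, tsum_ofReal_exp (by norm_num), phi_exp_neg_pi_div_three] at total
  have finite : residueSum f 1 ≠ ∞ := by
    intro h
    simp [h] at total
    exact absurd total (by finiteness)
  rw [tsum_ofReal_exp one_pos] at theta
  have hA := phi_exp_pos (a := 3) (by norm_num)
  have hP := phi_exp_pos one_pos
  rw [zero_class] at theta total
  generalize phi (rexp (-(3 * π))) = A at *
  generalize phi (rexp (-(1 * π))) = P at *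
  lift residueSum f 1 to NNReal using finite with B
  have total' := congrArg ENNReal.toReal total
  have theta' := congrArg ENNReal.toReal theta
  rw [ENNReal.toReal_add (by finiteness) (by finiteness),
    ENNReal.toReal_add (by finiteness) (by finiteness),
    ENNReal.toReal_ofReal (by positivity), ENNReal.toReal_ofReal hA.le] at total'
  rw [ENNReal.toReal_add (by finiteness) (by finiteness)] at theta'
  simp only [ENNReal.toReal_pow, ENNReal.toReal_mul, ENNReal.toReal_ofReal hA.le,
    ENNReal.toReal_ofReal hP.le, ENNReal.coe_toReal, ENNReal.toReal_ofNat] at theta' total'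
  have hB : (B : ℝ) = (√3 - 1) * A / 2 := by linarith
  have h3 : √3 ^ 2 = 3 := Real.sq_sqrt (by norm_num)
  rw [theta', hB]
  linear_combination (A ^ 4 * (√3 - 3)) * h3

theorem phi_exp_neg_three_pi :
    phi (Real.exp (-3 * π)) / phi (Real.exp (-π)) = 1 / (6 * Real.sqrt 3 - 9) ^ ((1:ℝ)/4) := by
  have hA := phi_exp_pos (a := 3) (by norm_num)
  have hP := phi_exp_pos one_pos
  have key := phi_exp_neg_pi_pow_four
  rw [one_mul] at hP key
  rw [neg_mul]
  have root : (6 * √3 - 9) = (phi (rexp (-π)) / phi (rexp (-(3 * π)))) ^ 4 := by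
    rw [div_pow, key]
    field_simp
  rw [root, ← Real.rpow_natCast, ← Real.rpow_mul (by positivity)]
  norm_num
end
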